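/- Let C₀ > 0 and M > 0, let g : ℝ → ℝ be an even measurable function with |g| ≤ M and g(x) = 0 for |x| > C₀, let ω : ℝ → ℝ be a nonnegative, even, integrable function with ∫_ℝ ω(t) dt = 1 whose cosine transform ŵ(ξ) := ∫_ℝ ω(t) cos(tξ) dt vanishes outside [−1,1], and set U_T(x,y) := (1/2)ŵ(T(x−y)) + (1/2)ŵ(T(x+y)) − ŵ(Tx)·ŵ(Ty). Then there is a constant C > 0, depending only on C₀ and M, such that for all T ≥ 1 and L ≥ 1: (16/L²) Σ_{k₁ ≥ 1} Σ_{k₂ ≥ 1} ∫₀^∞ ∫₀^∞ |g(k₁x/L)| · |g(k₂y/L)| · [sinh²(x/2) sinh²(y/2) / (sinh(k₁x/2) sinh(k₂y/2))] · |U_T(k₁x, k₂y)| dx dy ≤ C · e^{2C₀L} / (T L). -/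

import Mathlib

open MeasureTheory

theorem nat_mul_sinh_le_sinh (n : ℕ) {t : ℝ} (ht : 0 ≤ t) :
    n * Real.sinh t ≤ Real.sinh (n * t) := by
  induction n with
  | zero => simp
  | succ n ih =>
    have hs : 0 ≤ Real.sinh t := Real.sinh_nonneg_iff.2 ht
    have hn : 0 ≤ Real.sinh (n * t) := Real.sinh_nonneg_iff.2 (by positivity)
    push_cast
    rw [add_mul, one_mul, add_mul, one_mul, Real.sinh_add]
    nlinarith [Real.one_le_cosh t, Real.one_le_cosh (n * t)]

theorem sinh_le_exp (t : ℝ) : Real.sinh t ≤ Real.exp t := by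
  rw [Real.sinh_eq]
  linarith [Real.exp_pos t, Real.exp_pos (-t)]

theorem sinh_sq_div_sinh_nat_mul_le {k : ℕ} (hk : 0 < k) {x R : ℝ} (hx : 0 < x)
    (hR : k * x ≤ R) :
    Real.sinh (x / 2) ^ 2 / Real.sinh (k * x / 2) ≤ Real.exp (R / 2) / k ^ 2 := by
  have hk' : (0 : ℝ) < k := by exact_mod_cast hk
  have h : k * Real.sinh (x / 2) ≤ Real.sinh (k * x / 2) := by
    have := nat_mul_sinh_le_sinh k (t := x / 2) (by positivity)
    rwa [← mul_div_assoc] at this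
  have hs : 0 < Real.sinh (x / 2) := Real.sinh_pos_iff.2 (by positivity)
  have hS : 0 < Real.sinh (k * x / 2) := Real.sinh_pos_iff.2 (by positivity)
  have he : Real.sinh (k * x / 2) ≤ Real.exp (R / 2) :=
    (sinh_le_exp _).trans (Real.exp_le_exp.2 (by linarith))
  rw [div_le_div_iff₀ hS (by positivity)]
  calc Real.sinh (x / 2) ^ 2 * (k : ℝ) ^ 2 = (k * Real.sinh (x / 2)) ^ 2 := by ring
    _ ≤ Real.sinh (k * x / 2) ^ 2 := by gcongr
    _ = Real.sinh (k * x / 2) * Real.sinh (k * x / 2) := sq _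
    _ ≤ Real.exp (R / 2) * Real.sinh (k * x / 2) := by gcongr

theorem abs_integral_mul_cos_le_one {ω : ℝ → ℝ} (h0 : ∀ t, 0 ≤ ω t) (hi : Integrable ω)
    (h1 : ∫ t : ℝ, ω t = 1) (ξ : ℝ) : |∫ t : ℝ, ω t * Real.cos (t * ξ)| ≤ 1 := by
  rw [← h1, ← Real.norm_eq_abs]
  refine norm_integral_le_of_norm_le hi (Filter.Eventually.of_forall fun t => ?_)
  rw [norm_mul, Real.norm_eq_abs, Real.norm_eq_abs, abs_of_nonneg (h0 t)]
  exact mul_le_of_le_one_right (h0 t) (Real.abs_cos_le_one _)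

theorem abs_covariance_kernel_le_two {w : ℝ → ℝ} (hw : ∀ ξ, |w ξ| ≤ 1) (T u v : ℝ) :
    |(1 / 2) * w (T * (u - v)) + (1 / 2) * w (T * (u + v)) - w (T * u) * w (T * v)| ≤ 2 := by
  have h1 := abs_le.1 (hw (T * (u - v)))
  have h2 := abs_le.1 (hw (T * (u + v)))
  have h3 : |w (T * u) * w (T * v)| ≤ 1 := by
    rw [abs_mul]
    exact mul_le_one₀ (hw _) (abs_nonneg _) (hw _)
  have h4 := abs_le.1 h3
  exact abs_le.2 ⟨by linarith, by linarith⟩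

theorem covariance_kernel_eq_zero {w : ℝ → ℝ} (hw : ∀ ξ : ℝ, 1 < |ξ| → w ξ = 0) {T u v : ℝ}
    (hT : 0 < T) (hu : 0 < u) (hv : 0 < v) (h : 1 / T < |u - v|) :
    (1 / 2) * w (T * (u - v)) + (1 / 2) * w (T * (u + v)) - w (T * u) * w (T * v) = 0 := by
  rw [div_lt_iff₀' hT] at h
  have h1 : w (T * (u - v)) = 0 := hw _ (by rwa [abs_mul, abs_of_pos hT])
  have h2 : w (T * (u + v)) = 0 := by
    refine hw _ (h.trans_le ?_)
    rw [abs_mul, abs_of_pos hT]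
    gcongr 1
    rw [abs_of_pos (add_pos hu hv)]
    exact abs_le.2 ⟨by linarith, by linarith⟩
  have h3 : w (T * u) * w (T * v) = 0 := by
    rcases le_total u v with huv | huv
    · rw [hw (T * v), mul_zero]
      refine h.trans_le ?_
      rw [abs_of_pos (mul_pos hT hv)]
      gcongr
      exact abs_le.2 ⟨by linarith, by linarith⟩
    · rw [hw (T * u), zero_mul]
      refine h.trans_le ?_
      rw [abs_of_pos (mul_pos hT hu)]
      gcongr
      exact abs_le.2 ⟨by linarith, by linarith⟩
  rw [h1, h2, h3]
  ring

/-- A function on the quadrant that is bounded by `B` and vanishes outside a thin strip has a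
small iterated integral. -/
theorem integral_Ioi_Ioi_le_of_strip {F : ℝ → ℝ → ℝ} {B R δ a b : ℝ} (ha : 0 < a) (hb : 0 < b)
    (hB : 0 ≤ B) (hR : 0 ≤ R) (hδ : 0 ≤ δ)
    (hF : ∀ x y, 0 < x → 0 < y → 0 ≤ F x y)
    (hFB : ∀ x y, 0 < x → 0 < y → F x y ≤ B)
    (hFR : ∀ x y, 0 < x → 0 < y → R < a * x → F x y = 0)
    (hFδ : ∀ x y, 0 < x → 0 < y → δ < |a * x - b * y| → F x y = 0) :
    ∫ x in Set.Ioi (0 : ℝ), ∫ y in Set.Ioi (0 : ℝ), F x y ≤ R / a * (2 * δ / b * B) := by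
  have inner : ∀ x, 0 < x → ∫ y in Set.Ioi (0 : ℝ), F x y ≤ 2 * δ / b * B := by
    intro x hx
    set J := Set.Icc ((a * x - δ) / b) ((a * x + δ) / b) with hJ
    have hint : Integrable (J.indicator fun _ => B) :=
      (integrable_indicator_iff measurableSet_Icc).2
        (integrableOn_const measure_Icc_lt_top.ne)
    calc ∫ y in Set.Ioi (0 : ℝ), F x y
        ≤ ∫ y in Set.Ioi (0 : ℝ), J.indicator (fun _ => B) y := by
          refine integral_mono_of_nonneg ?_ hint.integrableOn ?_
          · exact (ae_restrict_iff' measurableSet_Ioi).2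
              (Filter.Eventually.of_forall fun y hy => hF x y hx hy)
          · refine (ae_restrict_iff' measurableSet_Ioi).2
              (Filter.Eventually.of_forall fun y hy => ?_)
            by_cases h : y ∈ J
            · rw [Set.indicator_of_mem h]
              exact hFB x y hx hy
            · rw [Set.indicator_of_notMem h]
              refine (hFδ x y hx hy ?_).le
              contrapose! h
              have := abs_le.1 h
              exact ⟨(div_le_iff₀' hb).2 (by linarith), (le_div_iff₀' hb).2 (by linarith)⟩
      _ ≤ ∫ y, J.indicator (fun _ => B) y :=
          setIntegral_le_integral hint
            (Filter.Eventually.of_forall fun y => Set.indicator_nonneg (fun _ _ => hB) y)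
      _ = 2 * δ / b * B := by
          have hl : (a * x + δ) / b - (a * x - δ) / b = 2 * δ / b := by ring
          rw [integral_indicator_const _ measurableSet_Icc, Real.volume_real_Icc, hl,
            max_eq_left (by positivity), smul_eq_mul]
  set K := Set.Ioc 0 (R / a) with hK
  have hint : Integrable (K.indicator fun _ => 2 * δ / b * B) :=
    (integrable_indicator_iff measurableSet_Ioc).2
      (integrableOn_const measure_Ioc_lt_top.ne)
  calc ∫ x in Set.Ioi (0 : ℝ), ∫ y in Set.Ioi (0 : ℝ), F x y
      ≤ ∫ x in Set.Ioi (0 : ℝ), K.indicator (fun _ => 2 * δ / b * B) x := by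
        refine integral_mono_of_nonneg ?_ hint.integrableOn ?_
        · exact (ae_restrict_iff' measurableSet_Ioi).2 (Filter.Eventually.of_forall fun x hx =>
            setIntegral_nonneg measurableSet_Ioi fun y hy => hF x y hx hy)
        · refine (ae_restrict_iff' measurableSet_Ioi).2
            (Filter.Eventually.of_forall fun x hx => ?_)
          by_cases h : x ∈ K
          · rw [Set.indicator_of_mem h]
            exact inner x hx
          · rw [Set.indicator_of_notMem h]
            refine (setIntegral_eq_zero_of_forall_eq_zero fun y hy => hFR x y hx hy ?_).le
            contrapose! h
            exact ⟨hx, (le_div_iff₀' ha).2 h⟩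
    _ ≤ ∫ x, K.indicator (fun _ => 2 * δ / b * B) x :=
        setIntegral_le_integral hint
          (Filter.Eventually.of_forall fun x => Set.indicator_nonneg (fun _ _ => by positivity) x)
    _ = R / a * (2 * δ / b * B) := by
        rw [integral_indicator_const _ measurableSet_Ioc, Real.volume_real_Ioc, sub_zero,
          max_eq_left (by positivity), smul_eq_mul]

theorem tsum_tsum_le_of_le_mul {ι : Type*} {f : ι → ι → ℝ} {s : ι → ℝ} {A : ℝ}
    (hs : Summable s) (hf : ∀ i j, 0 ≤ f i j) (hfs : ∀ i j, f i j ≤ A * (s i * s j)) :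
    ∑' i, ∑' j, f i j ≤ A * (∑' i, s i) ^ 2 := by
  have hrow : ∀ i, ∑' j, f i j ≤ A * (∑' j, s j) * s i := by
    intro i
    have hsum : Summable fun j => A * (s i * s j) := (hs.mul_left _).mul_left _
    calc ∑' j, f i j ≤ ∑' j, A * (s i * s j) :=
          (Summable.of_nonneg_of_le (hf i) (hfs i) hsum).tsum_le_tsum (hfs i) hsum
      _ = A * (∑' j, s j) * s i := by rw [tsum_mul_left, tsum_mul_left]; ring
  have hsum : Summable fun i => A * (∑' j, s j) * s i := hs.mul_left _
  calc ∑' i, ∑' j, f i j ≤ ∑' i, A * (∑' j, s j) * s i :=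
        (Summable.of_nonneg_of_le (fun i => tsum_nonneg (hf i)) hrow hsum).tsum_le_tsum hrow hsum
    _ = A * (∑' i, s i) ^ 2 := by rw [tsum_mul_left]; ring

/-- summed off-diagonal bound (Lemma 4.1). There is `C > 0` depending only on
`C₀, M` such that under the same hypotheses as Statement 3, for all `T, L ≥ 1`:
`(16/L²) Σ_{k₁,k₂ ≥ 1} ∫₀^∞∫₀^∞ |g(k₁x/L)||g(k₂y/L)| ·
 sinh²(x/2)sinh²(y/2)/(sinh(k₁x/2)sinh(k₂y/2)) · |U_T(k₁x,k₂y)| dy dx ≤ C e^{2C₀L}/(TL)`. -/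
theorem stmt_4 (C₀ M : ℝ) (hC₀ : 0 < C₀) (hM : 0 < M) :
    ∃ C : ℝ, 0 < C ∧
      ∀ (g ω w : ℝ → ℝ),
        Measurable g → (∀ x, g (-x) = g x) → (∀ x, |g x| ≤ M) →
        (∀ x, C₀ < |x| → g x = 0) →
        (∀ t, 0 ≤ ω t) → (∀ t, ω (-t) = ω t) → Integrable ω → (∫ t : ℝ, ω t = 1) →
        (∀ ξ : ℝ, w ξ = ∫ t : ℝ, ω t * Real.cos (t * ξ)) →
        (∀ ξ : ℝ, 1 < |ξ| → w ξ = 0) →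
        ∀ (U : ℝ → ℝ → ℝ → ℝ),
          (∀ T x y : ℝ, U T x y =
            (1 / 2) * w (T * (x - y)) + (1 / 2) * w (T * (x + y)) - w (T * x) * w (T * y)) →
        ∀ (T L : ℝ), 1 ≤ T → 1 ≤ L →
        (16 / L ^ 2) * (∑' (k₁ : ℕ+), ∑' (k₂ : ℕ+),
            ∫ x in Set.Ioi (0 : ℝ), ∫ y in Set.Ioi (0 : ℝ),
              |g (((k₁ : ℕ) : ℝ) * x / L)| * |g (((k₂ : ℕ) : ℝ) * y / L)| *
              (Real.sinh (x / 2) ^ 2 * Real.sinh (y / 2) ^ 2 /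
                (Real.sinh (((k₁ : ℕ) : ℝ) * x / 2) * Real.sinh (((k₂ : ℕ) : ℝ) * y / 2))) *
              |U T (((k₁ : ℕ) : ℝ) * x) (((k₂ : ℕ) : ℝ) * y)|)
          ≤ C * Real.exp (2 * C₀ * L) / (T * L) := by
  have hs : Summable fun k : ℕ+ => 1 / ((k : ℕ) : ℝ) ^ 2 :=
    (Real.summable_one_div_nat_pow.2 one_lt_two).comp_injective PNat.coe_injective
  have hS : 0 < ∑' k : ℕ+, 1 / ((k : ℕ) : ℝ) ^ 2 :=
    hs.tsum_pos (fun k => by positivity) 1 (by simp)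
  set S := ∑' k : ℕ+, 1 / ((k : ℕ) : ℝ) ^ 2
  refine ⟨64 * M ^ 2 * C₀ * S ^ 2, by positivity, ?_⟩
  intro g ω w _ _ hgM hgC hω0 _ hωi hω1 hw hw0 U hU T L hT hL
  have hT0 : 0 < T := by linarith
  have hL0 : 0 < L := by linarith
  have hw1 : ∀ ξ, |w ξ| ≤ 1 := fun ξ => by
    rw [hw]
    exact abs_integral_mul_cos_le_one hω0 hωi hω1 ξ
  have hg0 : ∀ u, 0 < u → C₀ * L < u → g (u / L) = 0 := fun u hu h =>
    hgC _ (by rwa [abs_of_pos (by positivity), lt_div_iff₀ hL0])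
  have hnn : ∀ (k : ℕ+) (x : ℝ), 0 < x →
      0 ≤ Real.sinh (x / 2) ^ 2 / Real.sinh (((k : ℕ) : ℝ) * x / 2) := fun k x hx =>
    div_nonneg (sq_nonneg _) (Real.sinh_nonneg_iff.2 (by positivity))
  have hterm : ∀ (k : ℕ+) (x : ℝ), 0 < x →
      |g (((k : ℕ) : ℝ) * x / L)| * (Real.sinh (x / 2) ^ 2 / Real.sinh (((k : ℕ) : ℝ) * x / 2))
        ≤ M * (Real.exp (C₀ * L / 2) / ((k : ℕ) : ℝ) ^ 2) := by
    intro k x hx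
    have hk : (0 : ℝ) < ((k : ℕ) : ℝ) := by exact_mod_cast k.pos
    rcases le_or_gt (((k : ℕ) : ℝ) * x) (C₀ * L) with h | h
    · exact mul_le_mul (hgM _) (sinh_sq_div_sinh_nat_mul_le k.pos hx h) (hnn k x hx) hM.le
    · rw [hg0 _ (by positivity) h, abs_zero, zero_mul]
      positivity
  have hdouble := tsum_tsum_le_of_le_mul (A := 4 * M ^ 2 * Real.exp (C₀ * L) * (C₀ * L) / T) hs
    (f := fun k₁ k₂ : ℕ+ => ∫ x in Set.Ioi (0 : ℝ), ∫ y in Set.Ioi (0 : ℝ),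
      |g (((k₁ : ℕ) : ℝ) * x / L)| * |g (((k₂ : ℕ) : ℝ) * y / L)| *
      (Real.sinh (x / 2) ^ 2 * Real.sinh (y / 2) ^ 2 /
        (Real.sinh (((k₁ : ℕ) : ℝ) * x / 2) * Real.sinh (((k₂ : ℕ) : ℝ) * y / 2))) *
      |U T (((k₁ : ℕ) : ℝ) * x) (((k₂ : ℕ) : ℝ) * y)|) ?_ ?_
  · calc _ ≤ 16 / L ^ 2 * (4 * M ^ 2 * Real.exp (C₀ * L) * (C₀ * L) / T * S ^ 2) := by gcongr
      _ = 64 * M ^ 2 * C₀ * S ^ 2 * Real.exp (C₀ * L) / (T * L) := by field_simp; ring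
      _ ≤ _ := by
        have : C₀ * L ≤ 2 * C₀ * L := by nlinarith [mul_pos hC₀ hL0]
        gcongr
  · intro k₁ k₂
    refine setIntegral_nonneg measurableSet_Ioi fun x hx =>
      setIntegral_nonneg measurableSet_Ioi fun y hy => ?_
    rw [mul_div_mul_comm]
    have h1 := hnn k₁ x hx
    have h2 := hnn k₂ y hy
    positivity
  · intro k₁ k₂
    have hk₁ : (1 : ℝ) ≤ ((k₁ : ℕ) : ℝ) := by exact_mod_cast k₁.pos
    have hk₂ : (1 : ℝ) ≤ ((k₂ : ℕ) : ℝ) := by exact_mod_cast k₂.pos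
    have hk₁' : (0 : ℝ) < ((k₁ : ℕ) : ℝ) := by linarith
    have hk₂' : (0 : ℝ) < ((k₂ : ℕ) : ℝ) := by linarith
    have hE : Real.exp (C₀ * L / 2) * Real.exp (C₀ * L / 2) = Real.exp (C₀ * L) := by
      rw [← Real.exp_add, add_halves]
    calc _ ≤ C₀ * L / ((k₁ : ℕ) : ℝ) * (2 * (1 / T) / ((k₂ : ℕ) : ℝ) *
            (M * (Real.exp (C₀ * L / 2) / ((k₁ : ℕ) : ℝ) ^ 2) *
              (M * (Real.exp (C₀ * L / 2) / ((k₂ : ℕ) : ℝ) ^ 2)) * 2)) := by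
          refine integral_Ioi_Ioi_le_of_strip hk₁' hk₂' (by positivity) (by positivity)
            (by positivity) ?_ ?_ ?_ ?_
          · intro x y hx hy
            rw [mul_div_mul_comm]
            have h1 := hnn k₁ x hx
            have h2 := hnn k₂ y hy
            positivity
          · intro x y hx hy
            rw [mul_div_mul_comm, mul_mul_mul_comm]
            have h1 := hnn k₁ x hx
            have h2 := hnn k₂ y hy
            refine mul_le_mul (mul_le_mul (hterm k₁ x hx) (hterm k₂ y hy) (by positivity)
              (by positivity)) ?_ (abs_nonneg _) (by positivity)
            rw [hU]
            exact abs_covariance_kernel_le_two hw1 _ _ _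
          · intro x y hx hy h
            rw [hg0 _ (by positivity) h]
            simp
          · intro x y hx hy h
            rw [hU, covariance_kernel_eq_zero hw0 hT0 (by positivity) (by positivity) h]
            simp
      _ ≤ C₀ * L / 1 * (2 * (1 / T) / 1 *
            (M * (Real.exp (C₀ * L / 2) / ((k₁ : ℕ) : ℝ) ^ 2) *
              (M * (Real.exp (C₀ * L / 2) / ((k₂ : ℕ) : ℝ) ^ 2)) * 2)) := by gcongr
      _ = _ := by
          rw [← hE]
          ring
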